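/- Let s′ = I(u′, L^{(N+1)/2} v) be the interleaved sequence of period 2N. Then for 0 ≤ τ < 2N: R_{s′}(0) = 2N; R_{s′}(τ) = −2 for every even τ ≠ 0; R_{s′}(N) = −2; and for every odd τ ≠ N, R_{s′}(τ) = −2 if ((τ+N)/2 mod N) ∈ D_0 ∪ D_2 and R_{s′}(τ) = 2 if ((τ+N)/2 mod N) ∈ D_1 ∪ D_3. -/

import Mathlib

open Finset Polynomial

def corr (n : ℕ) (a b : ℤ → ℕ) (τ : ℤ) : ℤ :=
  ∑ i ∈ Finset.range n, (-1 : ℤ) ^ (a i + b ((i : ℤ) + τ))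

def Dclass (N f : ℕ) (β : ZMod N) (j : ℕ) : Set (ZMod N) :=
  {x | ∃ k < f, x = β ^ (4 * k + j)}

open Classical in
/-- The binary sequence of period `N` whose characteristic set is `S ⊆ Z_N`. -/
noncomputable def chiSeq (N : ℕ) (S : Set (ZMod N)) : ℤ → ℕ :=
  fun t => if (t : ZMod N) ∈ S then 1 else 0

/-- The interleaved sequence `I(a,b)`: `I(a,b)(2i) = a(i)`, `I(a,b)(2i+1) = b(i)`. -/
noncomputable def interleave (a b : ℤ → ℕ) : ℤ → ℕ :=
  fun k => if Even k then a (k / 2) else b ((k - 1) / 2)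

/-- The left shift `L^m`. -/
def shiftL (m : ℤ) (a : ℤ → ℕ) : ℤ → ℕ := fun i => a (i + m)

section QuarticCharacters

local notation "ι" => (Zsqrtd.sqrtd : GaussianInt)

theorem GaussianInt.eq_of_pow_four_eq_one {z : GaussianInt} (hz : z ^ 4 = 1) :
    z = 1 ∨ z = -1 ∨ z = ι ∨ z = -ι := by
  have hι : ι * ι = -1 := by ext <;> simp
  have h : (z - 1) * ((z + 1) * ((z - ι) * (z + ι))) = 0 := by
    linear_combination hz + (1 - z ^ 2) * hι
  simpa [sub_eq_zero, add_eq_zero_iff_eq_neg] using h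

theorem GaussianInt.re_sum {α : Type*} (s : Finset α) (F : α → GaussianInt) :
    (∑ x ∈ s, F x).re = ∑ x ∈ s, (F x).re :=
  map_sum (⟨⟨Zsqrtd.re, rfl⟩, fun _ _ => rfl⟩ : GaussianInt →+ ℤ) F s

variable {F : Type*} [Field F]

variable {χ : MulChar F GaussianInt}

theorem MulChar.quartic_apply (hχ : χ ^ 4 = 1) {x : F} (hx : x ≠ 0) :
    χ x = 1 ∨ χ x = -1 ∨ χ x = ι ∨ χ x = -ι := by
  apply GaussianInt.eq_of_pow_four_eq_one
  rw [← MulChar.pow_apply' χ four_ne_zero, hχ, MulChar.one_apply hx.isUnit]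

theorem MulChar.star_quartic_apply (hχ : χ ^ 4 = 1) (x : F) : star (χ x) = χ⁻¹ x := by
  rcases eq_or_ne x 0 with rfl | hx
  · simp
  have h1 : χ x * star (χ x) = 1 := by
    rcases quartic_apply hχ hx with h | h | h | h <;> rw [h] <;> ext <;> simp
  have h2 : χ x * χ⁻¹ x = 1 := by
    rw [MulChar.inv_apply', ← map_mul, mul_inv_cancel₀ hx, map_one]
  calc star (χ x) = (χ x * χ⁻¹ x) * star (χ x) := by rw [h2, one_mul]
    _ = (χ x * star (χ x)) * χ⁻¹ x := by ring
    _ = χ⁻¹ x := by rw [h1, one_mul]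

variable [Fintype F]

theorem MulChar.sum_mul_apply_add {R : Type*} [CommRing R] (χ ψ : MulChar F R) {d : F}
    (hd : d ≠ 0) :
    ∑ t, χ t * ψ (t + d) = χ (-d) * ψ d * jacobiSum χ ψ := by
  rw [jacobiSum, Finset.mul_sum,
    ← Equiv.sum_comp (Equiv.mulLeft₀ (-d) (neg_ne_zero.2 hd)) fun t => χ t * ψ (t + d)]
  refine Finset.sum_congr rfl fun t _ => ?_
  rw [Equiv.mulLeft₀_apply, map_mul, show -d * t + d = d * (1 - t) by ring, map_mul]
  ring

theorem MulChar.sum_quartic_mul_star (hχ : χ ^ 4 = 1) (hχ1 : χ ≠ 1) {d : F} (hd : d ≠ 0) :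
    ∑ t, χ t * star (χ (t + d)) = -1 := by
  simp_rw [star_quartic_apply hχ]
  rw [sum_mul_apply_add _ _ hd, jacobiSum_nontrivial_inv hχ1, MulChar.inv_apply']
  calc χ (-d) * χ d⁻¹ * -χ (-1) = -χ (-d * d⁻¹ * -1) := by simp only [map_mul]; ring
    _ = -1 := by rw [show -d * d⁻¹ * -1 = 1 by field_simp, map_one]

theorem jacobiSum_quartic_norm (hχ : χ ^ 4 = 1) (hχ2 : χ ^ 2 ≠ 1) :
    (jacobiSum χ χ).re ^ 2 + (jacobiSum χ χ).im ^ 2 = Fintype.card F := by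
  have hinj := GaussianInt.toComplex_injective
  set φ := χ.ringHomComp GaussianInt.toComplex with hφ
  have hφ2 : φ * φ ≠ 1 := by
    rw [hφ, ← pow_two, MulChar.ringHomComp_pow]
    exact (MulChar.ringHomComp_ne_one_iff hinj).2 hχ2
  have hφ1 : φ ≠ 1 := fun h => hφ2 (by rw [h, one_mul])
  have hchar : ringChar ℂ ≠ ringChar F := by
    rw [ringChar.eq_zero]
    exact (CharP.ringChar_ne_zero_of_finite F).symm
  have h := jacobiSum_mul_jacobiSum_inv hchar hφ1 hφ1 hφ2
  rw [hφ, MulChar.ringHomComp_inv, jacobiSum_ringHomComp, jacobiSum_ringHomComp,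
    ← map_mul] at h
  have hs : jacobiSum χ⁻¹ χ⁻¹ = star (jacobiSum χ χ) := by
    simp only [jacobiSum, star_sum, star_mul', MulChar.star_quartic_apply hχ]
  have h' : jacobiSum χ χ * star (jacobiSum χ χ) = (Fintype.card F : GaussianInt) := by
    apply hinj
    rw [← hs, h, map_natCast]
  have := congrArg Zsqrtd.re h'
  simp at this
  linarith

theorem jacobiSum_quartic_re (hχ : χ ^ 4 = 1) (hχ2 : χ ^ 2 ≠ 1) (h4 : χ 4 = -1) :
    ∃ m : ℤ, Odd m ∧ 2 * (jacobiSum χ χ).re = Fintype.card F - 3 - 4 * m := by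
  classical
  have htwo : (2 : F) ≠ 0 := fun h => by
    rw [show (4 : F) = 2 * 2 by norm_num, h, mul_zero, MulChar.map_zero] at h4
    exact absurd (congrArg Zsqrtd.re h4) (by simp)
  set g : F → ℤ := fun s => (χ s * χ (1 - s)).re with hg
  set S : Finset F := {s | g s = -1} with hS
  have hcases : ∀ s, s ≠ 0 → s ≠ 1 → (χ s * χ (1 - s) = 1 ∨ χ s * χ (1 - s) = -1 ∨
      χ s * χ (1 - s) = ι ∨ χ s * χ (1 - s) = -ι) := fun s h0 h1 => by
    rw [← map_mul]
    exact MulChar.quartic_apply hχ (mul_ne_zero h0 (sub_ne_zero.2 h1.symm))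
  have hinv : (χ ^ 2)⁻¹ = χ ^ 2 := by
    rw [inv_eq_iff_mul_eq_one, ← pow_add, hχ]
  have hJ2 : (jacobiSum (χ ^ 2) (χ ^ 2)).re = -1 := by
    have := jacobiSum_nontrivial_inv hχ2
    rw [hinv, MulChar.pow_apply' χ two_ne_zero, ← map_pow] at this
    simp [this]
  refine ⟨S.card, ?_, ?_⟩
  · have hhalf : (2 : F)⁻¹ ∈ S := by
      have h1 : (1 : F) - 2⁻¹ = 2⁻¹ := by field_simp; norm_num
      have h2 : χ (2⁻¹ * 2⁻¹) * χ 4 = 1 := by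
        rw [← map_mul, show (2⁻¹ * 2⁻¹ * 4 : F) = 1 by field_simp; norm_num, map_one]
      have h3 : χ (2⁻¹ * 2⁻¹) = -1 := by
        rw [h4] at h2
        linear_combination -h2
      simp [hS, hg, h1, ← map_mul, h3]
    have hsum : ∑ _s ∈ S.erase 2⁻¹, (1 : ZMod 2) = 0 := by
      refine Finset.sum_involution (fun s _ => 1 - s) (fun _ _ => by decide) ?_ ?_ ?_
      · intro s hs _ h
        refine (Finset.mem_erase.1 hs).1 (eq_inv_of_mul_eq_one_left ?_)
        linear_combination -h
      · intro s hs
        obtain ⟨h1, h2⟩ := Finset.mem_erase.1 hs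
        refine Finset.mem_erase.2 ⟨fun h => h1 ?_, ?_⟩
        · have h3 : (2 : F) * 2⁻¹ = 1 := mul_inv_cancel₀ htwo
          linear_combination -h - h3
        · simpa [hS, hg, mul_comm] using h2
      · simp
    rw [Finset.sum_const, nsmul_one, ZMod.natCast_eq_zero_iff_even] at hsum
    rw [← Finset.card_erase_add_one hhalf]
    push_cast
    exact ((Int.even_coe_nat _).2 hsum).add_one
  · have hcard : (S.card : ℤ) = ∑ s, if g s = -1 then 1 else 0 := by simp [hS]
    have hone : (Fintype.card F : ℤ) - 2 = ∑ s : F, if s = 0 ∨ s = 1 then 0 else 1 := by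
      have : ∀ s : F, (if s = 0 ∨ s = 1 then (0 : ℤ) else 1)
          = 1 - (if s = 0 then 1 else 0) - (if s = 1 then 1 else 0) := fun s => by
        rcases eq_or_ne s 0 with rfl | h0
        · simp
        · simp [h0]; split_ifs <;> simp
      simp only [this, Finset.sum_sub_distrib]
      simp
      ring
    have key : 2 * (jacobiSum χ χ).re
        = (Fintype.card F - 2 : ℤ) + (jacobiSum (χ ^ 2) (χ ^ 2)).re - 4 * S.card := by
      rw [hcard, hone, jacobiSum, jacobiSum, GaussianInt.re_sum, GaussianInt.re_sum,
        Finset.mul_sum, Finset.mul_sum,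
        ← Finset.sum_add_distrib, ← Finset.sum_sub_distrib]
      refine Finset.sum_congr rfl fun s _ => ?_
      rw [MulChar.pow_apply' χ two_ne_zero, MulChar.pow_apply' χ two_ne_zero, ← mul_pow]
      by_cases h0 : s = 0
      · simp [hg, h0, MulChar.map_zero]
      by_cases h1 : s = 1
      · simp [hg, h1, MulChar.map_zero]
      simp only [hg]
      rcases hcases s h0 h1 with h | h | h | h <;> rw [h] <;> simp [h0, h1, pow_two]
    rw [key, hJ2]
    ring

/-- A representation of a prime as `1 + z ^ 2` with `z` even is essentially unique. -/
theorem sq_eq_one_of_sq_add_sq_eq {p : ℕ} (hp : p.Prime) {a b z : ℤ} (ha : Odd a) (hz : Even z)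
    (hab : a ^ 2 + b ^ 2 = p) (h : (p : ℤ) = 1 + z ^ 2) : a ^ 2 = 1 := by
  have hp0 : (p : ℤ) ≠ 0 := by exact_mod_cast hp.ne_zero
  have aux : ∀ b : ℤ, a ^ 2 + b ^ 2 = p → (p : ℤ) ∣ a * z - b → a ^ 2 = 1 := by
    rintro b hab ⟨c, hc⟩
    have h1 : (p : ℤ) * p = (a + b * z) ^ 2 + (p * c) ^ 2 := by
      rw [← hc]
      linear_combination (-(1 + z ^ 2)) * hab + p * h
    have hc1 : c ^ 2 ≤ 1 := by
      have : (p : ℤ) ^ 2 * c ^ 2 ≤ p ^ 2 * 1 := by nlinarith [sq_nonneg (a + b * z)]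
      exact le_of_mul_le_mul_left this (by positivity)
    rcases eq_or_ne c 0 with rfl | hc0
    · have hb : b = a * z := by linarith
      have : (p : ℤ) * (a ^ 2 - 1) = 0 := by
        rw [hb] at hab
        linear_combination hab + a ^ 2 * h
      rcases mul_eq_zero.1 this with h | h
      · exact absurd h hp0
      · linarith
    · have hc2 : c ^ 2 = 1 := le_antisymm hc1 (by have := sq_pos_of_ne_zero hc0; omega)
      have h0 : a + b * z = 0 := by
        apply pow_eq_zero_iff two_ne_zero |>.1
        linear_combination (-1) * h1 + p ^ 2 * (-1) * hc2
      exfalso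
      have : a = -(b * z) := by linarith
      rw [this] at ha
      exact Int.not_odd_iff_even.2 (hz.mul_left b).neg ha
  have hdvd : (p : ℤ) ∣ (a * z - b) * (a * z - -b) :=
    ⟨a ^ 2 - 1, by linear_combination (-1) * hab - a ^ 2 * h⟩
  rcases (Nat.prime_iff_prime_int.1 hp).dvd_or_dvd hdvd with h' | h'
  · exact aux b hab h'
  · exact aux (-b) (by rw [neg_sq, hab]) h'

end QuarticCharacters

section PrimitiveRoot

local notation "ι" => (Zsqrtd.sqrtd : GaussianInt)

variable {N f : ℕ} [Fact N.Prime] {β : ZMod N}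

theorem exists_pow_eq_of_orderOf_eq (hβ : orderOf β = N - 1) {x : ZMod N} (hx : x ≠ 0) :
    ∃ k < N - 1, β ^ k = x := by
  have hN := (Fact.out : N.Prime).two_le
  have : NeZero (N - 1) := ⟨by omega⟩
  exact (hβ ▸ IsPrimitiveRoot.orderOf β).eq_pow_of_pow_eq_one (ZMod.pow_card_sub_one_eq_one hx)

theorem ne_zero_of_orderOf_eq (hβ : orderOf β = N - 1) : β ≠ 0 := by
  have hN := (Fact.out : N.Prime).two_le
  rintro rfl
  have := pow_orderOf_eq_one (0 : ZMod N)
  rw [hβ, zero_pow (by omega)] at this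
  exact zero_ne_one this

theorem sqrtd_neg_one_sq : ι ^ 2 = -1 := by ext <;> simp [pow_two]

theorem sqrtd_neg_one_pow_four_mul_add (k j : ℕ) : ι ^ (4 * k + j) = ι ^ j := by
  rw [pow_add, pow_mul, show ι ^ 4 = 1 by rw [pow_mul ι 2 2, sqrtd_neg_one_sq]; norm_num,
    one_pow, one_mul]

theorem exists_mulChar_apply_eq_sqrtd (hβ : orderOf β = N - 1) (h4 : 4 ∣ N - 1) :
    ∃ χ : MulChar (ZMod N) GaussianInt, χ β = ι := by
  have hι : ι * -ι = 1 := by ext <;> simp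
  have hroot : (⟨ι, -ι, hι, by rw [mul_comm, hι]⟩ : GaussianIntˣ) ∈
      rootsOfUnity (Fintype.card (ZMod N)ˣ) GaussianInt := by
    rw [mem_rootsOfUnity, ZMod.card_units]
    obtain ⟨c, hc⟩ := h4
    ext1
    simpa [hc] using sqrtd_neg_one_pow_four_mul_add c 0
  have hgen : ∀ x, x ∈ Subgroup.zpowers (Units.mk0 β (ne_zero_of_orderOf_eq hβ)) := fun x => by
    obtain ⟨k, -, hk⟩ := exists_pow_eq_of_orderOf_eq hβ x.ne_zero
    exact ⟨k, by ext1; simpa using hk⟩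
  exact ⟨_, MulChar.ofRootOfUnity_spec hroot hgen⟩

variable {χ : MulChar (ZMod N) GaussianInt}

theorem exists_apply_eq_sqrtd_pow (hβ : orderOf β = N - 1) (hχβ : χ β = ι) {x : ZMod N}
    (hx : x ≠ 0) : ∃ k < N - 1, β ^ k = x ∧ χ x = ι ^ k := by
  obtain ⟨k, hk, rfl⟩ := exists_pow_eq_of_orderOf_eq hβ hx
  exact ⟨k, hk, rfl, by rw [map_pow, hχβ]⟩

theorem pow_four_eq_one_of_apply_eq_sqrtd (hβ : orderOf β = N - 1) (hχβ : χ β = ι) :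
    χ ^ 4 = 1 := by
  ext1 x
  obtain ⟨k, -, -, hk⟩ := exists_apply_eq_sqrtd_pow hβ hχβ x.ne_zero
  rw [MulChar.pow_apply' χ four_ne_zero, MulChar.one_apply_coe, hk, ← pow_mul, mul_comm]
  simpa using sqrtd_neg_one_pow_four_mul_add k 0

theorem sq_ne_one_of_apply_eq_sqrtd (hβ : orderOf β = N - 1) (hχβ : χ β = ι) : χ ^ 2 ≠ 1 := by
  intro h
  have h1 := MulChar.pow_apply' χ two_ne_zero β
  rw [h, MulChar.one_apply (ne_zero_of_orderOf_eq hβ).isUnit, hχβ, sqrtd_neg_one_sq] at h1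
  exact absurd (congrArg Zsqrtd.re h1) (by simp)

theorem apply_neg_one_of_apply_eq_sqrtd (hβ : orderOf β = N - 1) (hχβ : χ β = ι)
    (hNf : N = 4 * f + 1) (hf : Odd f) : χ (-1) = -1 := by
  obtain ⟨k, hk, hk1, hk2⟩ := exists_apply_eq_sqrtd_pow hβ hχβ (neg_ne_zero.2 one_ne_zero)
  have hdvd : 4 * f ∣ k * 2 := by
    rw [show 4 * f = orderOf β by rw [hβ]; omega]
    apply orderOf_dvd_of_pow_eq_one
    rw [pow_mul, hk1]
    norm_num
  have hk0 : k ≠ 0 := by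
    rintro rfl
    have : Fact (2 < N) := ⟨by have := hf.pos; omega⟩
    exact ZMod.neg_one_ne_one (by simpa using hk1.symm)
  have : k = 2 * f := by
    obtain ⟨c, hc⟩ := hdvd
    have hc2 : c < 2 := by
      by_contra! h
      have := Nat.mul_le_mul_left (4 * f) h
      omega
    interval_cases c <;> omega
  rw [hk2, this, pow_mul, sqrtd_neg_one_sq, hf.neg_one_pow]

theorem apply_four_of_apply_eq_sqrtd (hβ : orderOf β = N - 1) (hχβ : χ β = ι)
    (hNf : N = 4 * f + 1) (hf : Odd f) : χ 4 = -1 := by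
  have hfpos := hf.pos
  have h2 : ¬ IsSquare (2 : ZMod N) := by
    rw [ZMod.exists_sq_eq_two_iff (by omega)]
    obtain ⟨c, rfl⟩ := hf
    omega
  obtain ⟨k, -, hk1, hk2⟩ := exists_apply_eq_sqrtd_pow hβ hχβ (x := 2)
    fun h => h2 (h ▸ IsSquare.zero)
  have hk : Odd k := by
    rw [← Nat.not_even_iff_odd]
    exact fun h => h2 (hk1 ▸ h.isSquare_pow β)
  rw [show (4 : ZMod N) = 2 * 2 by norm_num, map_mul, hk2, ← mul_pow, ← pow_two,
    sqrtd_neg_one_sq, hk.neg_one_pow]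

theorem zero_notMem_Dclass (hβ : orderOf β = N - 1) (j : ℕ) : (0 : ZMod N) ∉ Dclass N f β j :=
  fun ⟨_, _, h⟩ => pow_ne_zero _ (ne_zero_of_orderOf_eq hβ) h.symm

theorem mem_Dclass_iff (hβ : orderOf β = N - 1) (hχβ : χ β = ι) (hNf : N = 4 * f + 1)
    {x : ZMod N} (hx : x ≠ 0) {j : ℕ} (hj : j < 4) : x ∈ Dclass N f β j ↔ χ x = ι ^ j := by
  constructor
  · rintro ⟨k, -, rfl⟩
    rw [map_pow, hχβ, sqrtd_neg_one_pow_four_mul_add]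
  · intro h
    obtain ⟨k, hk, hk1, hk2⟩ := exists_apply_eq_sqrtd_pow hβ hχβ hx
    rw [h, ← Nat.div_add_mod k 4, sqrtd_neg_one_pow_four_mul_add] at hk2
    have hmod : j = k % 4 := by
      have hk4 := Nat.mod_lt k four_pos
      have hre := congrArg Zsqrtd.re hk2
      have him := congrArg Zsqrtd.im hk2
      generalize k % 4 = r at *
      interval_cases j <;> interval_cases r <;>
        first | rfl | simp [pow_succ] at hre him
    exact ⟨k / 4, by omega, by rw [hmod, Nat.div_add_mod, hk1]⟩

/-- The real part of the Jacobi sum of a quartic character over `ZMod N`, `N = 1 + 4 * y ^ 2`. -/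
theorem jacobiSum_quartic_re_eq_neg_one (hβ : orderOf β = N - 1) (hχβ : χ β = ι)
    (hNf : N = 4 * f + 1) (hf : Odd f) {y : ℕ} (hfy : f = y ^ 2) :
    (jacobiSum χ χ).re = -1 := by
  have hχ4 := pow_four_eq_one_of_apply_eq_sqrtd hβ hχβ
  have hχ2 := sq_ne_one_of_apply_eq_sqrtd hβ hχβ
  have hnorm := jacobiSum_quartic_norm hχ4 hχ2
  obtain ⟨m, ⟨c, rfl⟩, hm⟩ :=
    jacobiSum_quartic_re hχ4 hχ2 (apply_four_of_apply_eq_sqrtd hβ hχβ hNf hf)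
  rw [ZMod.card] at hnorm hm
  obtain ⟨d, hd⟩ := hf
  have hNd : (N : ℤ) = 8 * d + 5 := by omega
  have hsq : (jacobiSum χ χ).re ^ 2 = 1 := by
    refine sq_eq_one_of_sq_add_sq_eq Fact.out (z := 2 * y) ?_ (even_two_mul _) hnorm ?_
    · exact ⟨2 * d - 2 * c - 1, by omega⟩
    · rw [hNf, hfy]
      push_cast
      ring
  rcases sq_eq_one_iff.1 hsq with h | h
  · omega
  · exact h

end PrimitiveRoot

section Correlation

theorem Finset.sum_range_two_mul {M : Type*} [AddCommMonoid M] (n : ℕ) (F : ℕ → M) :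
    ∑ i ∈ Finset.range (2 * n), F i = ∑ i ∈ Finset.range n, (F (2 * i) + F (2 * i + 1)) := by
  induction n with
  | zero => simp
  | succ n ih =>
    rw [Nat.mul_succ, Finset.sum_range_succ, Finset.sum_range_succ, ih, Finset.sum_range_succ,
      add_assoc]

theorem ZMod.sum_range_natCast {M : Type*} [AddCommMonoid M] (n : ℕ) [NeZero n]
    (F : ZMod n → M) : ∑ i ∈ Finset.range n, F i = ∑ x, F x := by
  refine Finset.sum_bij' (fun i _ => (i : ZMod n)) (fun x _ => x.val) ?_ ?_ ?_ ?_ ?_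
  · simp
  · simp [ZMod.val_lt]
  · intro i hi
    exact ZMod.val_cast_of_lt (Finset.mem_range.1 hi)
  · simp
  · simp

theorem interleave_two_mul (a b : ℤ → ℕ) (i : ℤ) : interleave a b (2 * i) = a i := by
  simp [interleave]

theorem interleave_two_mul_add_one (a b : ℤ → ℕ) (i : ℤ) :
    interleave a b (2 * i + 1) = b i := by
  simp [interleave]

variable {N : ℕ} [NeZero N] {a b : ℤ → ℕ} {A B : ZMod N → ℤ}

theorem corr_interleave_even (ha : ∀ t : ℤ, (-1 : ℤ) ^ a t = A t)
    (hb : ∀ t : ℤ, (-1 : ℤ) ^ b t = B t) (e m : ℤ) :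
    corr (2 * N) (interleave a (shiftL e b)) (interleave a (shiftL e b)) (2 * m) =
      ∑ x, (A x * A (x + m) + B x * B (x + m)) := by
  have h : ∀ i : ℕ,
      (-1 : ℤ) ^ (interleave a (shiftL e b) ((2 * i : ℕ) : ℤ) +
        interleave a (shiftL e b) (((2 * i : ℕ) : ℤ) + 2 * m)) +
      (-1 : ℤ) ^ (interleave a (shiftL e b) ((2 * i + 1 : ℕ) : ℤ) +
        interleave a (shiftL e b) (((2 * i + 1 : ℕ) : ℤ) + 2 * m)) =
      A i * A (i + m) + B (i + e) * B (i + e + m) := fun i => by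
    push_cast
    rw [show (2 * i + 2 * m : ℤ) = 2 * (i + m) by ring,
      show (2 * i + 1 + 2 * m : ℤ) = 2 * (i + m) + 1 by ring,
      interleave_two_mul, interleave_two_mul, interleave_two_mul_add_one,
      interleave_two_mul_add_one, shiftL, shiftL, pow_add, pow_add, ha, ha, hb, hb]
    push_cast
    rw [add_right_comm (i : ZMod N) m e]
  rw [corr, Finset.sum_range_two_mul, Finset.sum_congr rfl fun i _ => h i,
    ZMod.sum_range_natCast N fun x => A x * A (x + m) + B (x + e) * B (x + e + m),
    Finset.sum_add_distrib, Finset.sum_add_distrib]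
  congr 1
  exact Equiv.sum_comp (Equiv.addRight (e : ZMod N)) fun x => B x * B (x + m)

theorem corr_interleave_odd (ha : ∀ t : ℤ, (-1 : ℤ) ^ a t = A t)
    (hb : ∀ t : ℤ, (-1 : ℤ) ^ b t = B t) {e m : ℤ} (he : 2 * (e : ZMod N) = 1) :
    corr (2 * N) (interleave a (shiftL e b)) (interleave a (shiftL e b)) (2 * m + 1) =
      ∑ x, (A x * B (x + (m + e)) + B x * A (x + (m + e))) := by
  have h : ∀ i : ℕ,
      (-1 : ℤ) ^ (interleave a (shiftL e b) ((2 * i : ℕ) : ℤ) +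
        interleave a (shiftL e b) (((2 * i : ℕ) : ℤ) + (2 * m + 1))) +
      (-1 : ℤ) ^ (interleave a (shiftL e b) ((2 * i + 1 : ℕ) : ℤ) +
        interleave a (shiftL e b) (((2 * i + 1 : ℕ) : ℤ) + (2 * m + 1))) =
      A i * B (i + (m + e)) + B (i + e) * A (i + e + (m + e)) := fun i => by
    push_cast
    rw [show (2 * i + (2 * m + 1) : ℤ) = 2 * (i + m) + 1 by ring,
      show (2 * i + 1 + (2 * m + 1) : ℤ) = 2 * (i + m + 1) by ring,
      interleave_two_mul, interleave_two_mul, interleave_two_mul_add_one,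
      interleave_two_mul_add_one, shiftL, shiftL, pow_add, pow_add, ha, ha, hb, hb]
    push_cast
    rw [show (i + e + (m + e) : ZMod N) = i + m + 1 by linear_combination he, add_assoc]
  rw [corr, Finset.sum_range_two_mul, Finset.sum_congr rfl fun i _ => h i,
    ZMod.sum_range_natCast N fun x =>
      A x * B (x + (m + e)) + B (x + e) * A (x + e + (m + e)),
    Finset.sum_add_distrib, Finset.sum_add_distrib]
  congr 1
  exact Equiv.sum_comp (Equiv.addRight (e : ZMod N)) fun x => B x * A (x + (m + e))

theorem corr_self_zero (n : ℕ) (s : ℤ → ℕ) : corr n s s 0 = n := by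
  simp [corr, ← two_mul]

end Correlation

section QuarticSequences

local notation "ι" => (Zsqrtd.sqrtd : GaussianInt)

variable {N f : ℕ} [Fact N.Prime] {β : ZMod N} {χ : MulChar (ZMod N) GaussianInt}

theorem neg_one_pow_chiSeq (N : ℕ) (S : Set (ZMod N)) [DecidablePred (· ∈ S)] (t : ℤ) :
    (-1 : ℤ) ^ chiSeq N S t = if (t : ZMod N) ∈ S then -1 else 1 := by
  unfold chiSeq
  split_ifs <;> simp

theorem neg_one_pow_chiSeq_zero_one (hβ : orderOf β = N - 1) (hχβ : χ β = ι)
    (hNf : N = 4 * f + 1) (t : ℤ) :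
    (-1 : ℤ) ^ chiSeq N ({0} ∪ Dclass N f β 0 ∪ Dclass N f β 1) t =
      -((χ t).re + (χ t).im + if (t : ZMod N) = 0 then 1 else 0) := by
  classical
  rw [neg_one_pow_chiSeq]
  generalize (t : ZMod N) = x
  by_cases hx : x = 0
  · simp [hx, MulChar.map_zero]
  have hmem : x ∈ ({0} ∪ Dclass N f β 0 ∪ Dclass N f β 1 : Set (ZMod N)) ↔
      χ x = 1 ∨ χ x = ι := by
    rw [Set.mem_union, Set.mem_union, Set.mem_singleton_iff, or_iff_right hx,
      mem_Dclass_iff hβ hχβ hNf hx (by norm_num), mem_Dclass_iff hβ hχβ hNf hx (by norm_num),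
      pow_zero, pow_one]
  rw [if_neg hx]
  have hχ4 := pow_four_eq_one_of_apply_eq_sqrtd hβ hχβ
  rcases MulChar.quartic_apply hχ4 hx with h | h | h | h
  · rw [if_pos (hmem.2 (Or.inl h)), h]
    simp
  · rw [if_neg (by rw [hmem, h]; simp [Zsqrtd.ext_iff]), h]
    simp
  · rw [if_pos (hmem.2 (Or.inr h)), h]
    simp
  · rw [if_neg (by rw [hmem, h]; simp [Zsqrtd.ext_iff]), h]
    simp

theorem neg_one_pow_chiSeq_one_two (hβ : orderOf β = N - 1) (hχβ : χ β = ι)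
    (hNf : N = 4 * f + 1) (t : ℤ) :
    (-1 : ℤ) ^ chiSeq N (Dclass N f β 1 ∪ Dclass N f β 2) t =
      (χ t).re - (χ t).im + if (t : ZMod N) = 0 then 1 else 0 := by
  classical
  rw [neg_one_pow_chiSeq]
  generalize (t : ZMod N) = x
  by_cases hx : x = 0
  · simp [hx, MulChar.map_zero, zero_notMem_Dclass hβ]
  have hmem : x ∈ Dclass N f β 1 ∪ Dclass N f β 2 ↔ χ x = ι ∨ χ x = -1 := by
    rw [Set.mem_union, mem_Dclass_iff hβ hχβ hNf hx (by norm_num),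
      mem_Dclass_iff hβ hχβ hNf hx (by norm_num), pow_one, sqrtd_neg_one_sq]
  rw [if_neg hx]
  have hχ4 := pow_four_eq_one_of_apply_eq_sqrtd hβ hχβ
  rcases MulChar.quartic_apply hχ4 hx with h | h | h | h
  · rw [if_neg (by rw [hmem, h]; simp [Zsqrtd.ext_iff]), h]
    simp
  · rw [if_pos (hmem.2 (Or.inr h)), h]
    simp
  · rw [if_pos (hmem.2 (Or.inl h)), h]
    simp
  · rw [if_neg (by rw [hmem, h]; simp [Zsqrtd.ext_iff]), h]
    simp

theorem sum_quartic_even (hχ : χ ^ 4 = 1) (hχ1 : χ ≠ 1) (hneg : χ (-1) = -1) {A B : ZMod N → ℤ}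
    (hA : ∀ x, A x = -((χ x).re + (χ x).im + if x = 0 then 1 else 0))
    (hB : ∀ x, B x = (χ x).re - (χ x).im + if x = 0 then 1 else 0)
    {d : ZMod N} (hd : d ≠ 0) :
    ∑ x, (A x * A (x + d) + B x * B (x + d)) = -2 := by
  have h : ∀ x, A x * A (x + d) + B x * B (x + d) = 2 * (χ x * star (χ (x + d))).re +
      (if x = 0 then 2 * (χ d).re else 0) + if x = -d then 2 * (χ (-d)).re else 0 := fun x => by
    simp only [hA, hB, ← eq_neg_iff_add_eq_zero]
    by_cases h0 : x = 0
    · simp [h0, hd, MulChar.map_zero]; ring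
    by_cases h1 : x = -d
    · simp [h1, hd, MulChar.map_zero]; ring
    · simp [h0, h1]; ring
  have hnegd : χ (-d) = -χ d := by rw [← neg_one_mul d, map_mul, hneg, neg_one_mul]
  simp only [h, Finset.sum_add_distrib, ← Finset.mul_sum, ← GaussianInt.re_sum,
    MulChar.sum_quartic_mul_star hχ hχ1 hd]
  simp [hnegd]

theorem sum_quartic_odd (hneg : χ (-1) = -1) {A B : ZMod N → ℤ}
    (hA : ∀ x, A x = -((χ x).re + (χ x).im + if x = 0 then 1 else 0))
    (hB : ∀ x, B x = (χ x).re - (χ x).im + if x = 0 then 1 else 0)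
    {d : ZMod N} (hd : d ≠ 0) :
    ∑ x, (A x * B (x + d) + B x * A (x + d)) = 2 * (χ d ^ 2 * jacobiSum χ χ).re := by
  have h : ∀ x, A x * B (x + d) + B x * A (x + d) = -2 * (χ x * χ (x + d)).re -
      (if x = 0 then 2 * (χ d).re else 0) - if x = -d then 2 * (χ (-d)).re else 0 := fun x => by
    simp only [hA, hB, ← eq_neg_iff_add_eq_zero]
    by_cases h0 : x = 0
    · simp [h0, hd, MulChar.map_zero]; ring
    by_cases h1 : x = -d
    · simp [h1, hd, MulChar.map_zero]; ring
    · simp [h0, h1]; ring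
  have hnegd : χ (-d) = -χ d := by rw [← neg_one_mul d, map_mul, hneg, neg_one_mul]
  simp only [h, Finset.sum_sub_distrib, ← Finset.mul_sum, ← GaussianInt.re_sum,
    MulChar.sum_mul_apply_add χ χ hd]
  simp [hnegd, pow_two]
  ring

theorem sum_quartic_zero (hχ2 : χ ^ 2 ≠ 1) {A B : ZMod N → ℤ}
    (hA : ∀ x, A x = -((χ x).re + (χ x).im + if x = 0 then 1 else 0))
    (hB : ∀ x, B x = (χ x).re - (χ x).im + if x = 0 then 1 else 0) :
    ∑ x, (A x * B x + B x * A x) = -2 := by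
  have h : ∀ x, A x * B x + B x * A x =
      -2 * ((χ ^ 2) x).re - if x = 0 then 2 else 0 := fun x => by
    rw [MulChar.pow_apply' χ two_ne_zero, hA, hB]
    by_cases h0 : x = 0
    · simp [h0, MulChar.map_zero]
    · simp [h0, pow_two]; ring
  simp only [h, Finset.sum_sub_distrib, ← Finset.mul_sum, ← GaussianInt.re_sum,
    MulChar.sum_eq_zero_of_ne_one hχ2]
  simp

end QuarticSequences

/-- autocorrelation of `s' = I(u', L^{(N+1)/2} v)`. -/
theorem stmt6 (N f y : ℕ) (hprime : N.Prime) (hNf : N = 4 * f + 1) (hN5 : 5 ≤ N)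
    (hfy : f = y ^ 2) (hy : 0 < y) (hfodd : Odd f)
    (β : ZMod N) (hβ : orderOf β = N - 1)
    (u' v s' : ℤ → ℕ)
    (hu' : u' = chiSeq N ({0} ∪ Dclass N f β 0 ∪ Dclass N f β 1))
    (hv : v = chiSeq N (Dclass N f β 1 ∪ Dclass N f β 2))
    (hs' : s' = interleave u' (shiftL (((N + 1) / 2 : ℕ) : ℤ) v)) :
    ∀ τ : ℤ, 0 ≤ τ → τ < 2 * N →
      (τ = 0 → corr (2 * N) s' s' τ = 2 * N) ∧
      (Even τ → τ ≠ 0 → corr (2 * N) s' s' τ = -2) ∧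
      (τ = N → corr (2 * N) s' s' τ = -2) ∧
      (Odd τ → τ ≠ N →
        ((((τ + N) / 2 : ℤ) : ZMod N) ∈ Dclass N f β 0 ∪ Dclass N f β 2 →
          corr (2 * N) s' s' τ = -2) ∧
        ((((τ + N) / 2 : ℤ) : ZMod N) ∈ Dclass N f β 1 ∪ Dclass N f β 3 →
          corr (2 * N) s' s' τ = 2)) := by
  have hp : Fact N.Prime := ⟨hprime⟩
  obtain ⟨χ, hχβ⟩ := exists_mulChar_apply_eq_sqrtd hβ (by omega)
  have hχ4 := pow_four_eq_one_of_apply_eq_sqrtd hβ hχβ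
  have hχ2 := sq_ne_one_of_apply_eq_sqrtd hβ hχβ
  have hχ1 : χ ≠ 1 := fun h => hχ2 (by rw [h, one_pow])
  have hneg := apply_neg_one_of_apply_eq_sqrtd hβ hχβ hNf hfodd
  have hJ := jacobiSum_quartic_re_eq_neg_one hβ hχβ hNf hfodd hfy
  set A : ZMod N → ℤ := fun x => -((χ x).re + (χ x).im + if x = 0 then 1 else 0)
  set B : ZMod N → ℤ := fun x => (χ x).re - (χ x).im + if x = 0 then 1 else 0
  have hu : ∀ t : ℤ, (-1 : ℤ) ^ u' t = A t := hu' ▸ neg_one_pow_chiSeq_zero_one hβ hχβ hNf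
  have hv : ∀ t : ℤ, (-1 : ℤ) ^ v t = B t := hv ▸ neg_one_pow_chiSeq_one_two hβ hχβ hNf
  have hN0 : (N : ZMod N) = 0 := ZMod.natCast_self N
  have he : 2 * ((((N + 1) / 2 : ℕ) : ℤ) : ZMod N) = 1 := by
    have : 2 * ((N + 1) / 2) = N + 1 := by omega
    rw [Int.cast_natCast]
    exact_mod_cast (congrArg (Nat.cast : ℕ → ZMod N) this).trans (by simp)
  have hodd : ∀ m : ℤ, corr (2 * N) s' s' (2 * m + 1) =
      ∑ x, (A x * B (x + ((2 * m + 1 + N) / 2 : ℤ)) +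
        B x * A (x + ((2 * m + 1 + N) / 2 : ℤ))) := fun m => by
    rw [hs', corr_interleave_odd hu hv he,
      show (2 * m + 1 + N) / 2 = m + (((N + 1) / 2 : ℕ) : ℤ) by omega, Int.cast_add]
  have hoddval : ∀ τ : ℤ, Odd τ → (((τ + N) / 2 : ℤ) : ZMod N) ≠ 0 → corr (2 * N) s' s' τ =
      2 * (χ ((τ + N) / 2 : ℤ) ^ 2 * jacobiSum χ χ).re := by
    rintro _ ⟨m, rfl⟩ hd
    rw [hodd, sum_quartic_odd hneg (fun _ => rfl) (fun _ => rfl) hd]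
  have hne : ∀ {x : ZMod N} {j k : ℕ}, x ∈ Dclass N f β j ∪ Dclass N f β k → x ≠ 0 := by
    rintro x j k h rfl
    exact h.elim (zero_notMem_Dclass hβ j) (zero_notMem_Dclass hβ k)
  intro τ hτ0 hτN
  refine ⟨?_, ?_, ?_, fun hτ _ => ⟨fun h => ?_, fun h => ?_⟩⟩
  · rintro rfl
    rw [corr_self_zero]
    push_cast
    rfl
  · rintro ⟨m, rfl⟩ hm
    have hm0 : (m : ZMod N) ≠ 0 := by
      rw [Ne, ZMod.intCast_zmod_eq_zero_iff_dvd]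
      exact fun h => absurd (Int.le_of_dvd (by omega) h) (by omega)
    rw [← two_mul, hs', corr_interleave_even hu hv,
      sum_quartic_even hχ4 hχ1 hneg (fun _ => rfl) (fun _ => rfl) hm0]
  · rintro rfl
    have h0 : (((2 * (2 * f : ℕ) + 1 + N) / 2 : ℤ) : ZMod N) = 0 := by
      rw [show (2 * (2 * f : ℕ) + 1 + N : ℤ) / 2 = N by omega, Int.cast_natCast, hN0]
    rw [show (N : ℤ) = 2 * (2 * f : ℕ) + 1 by omega, hodd, h0]
    simp only [add_zero]
    exact sum_quartic_zero hχ2 (fun _ => rfl) (fun _ => rfl)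
  · have hd := hne h
    rw [hoddval τ hτ hd]
    have hsq : χ ((τ + N) / 2 : ℤ) ^ 2 = 1 := by
      rcases h with h' | h' <;> rw [(mem_Dclass_iff hβ hχβ hNf hd (by norm_num)).1 h'] <;>
        simp [sqrtd_neg_one_sq]
    rw [hsq, one_mul, hJ]
    norm_num
  · have hd := hne h
    rw [hoddval τ hτ hd]
    have hsq : χ ((τ + N) / 2 : ℤ) ^ 2 = -1 := by
      rcases h with h' | h' <;> rw [(mem_Dclass_iff hβ hχβ hNf hd (by norm_num)).1 h'] <;>
        rw [← pow_mul, mul_comm, pow_mul, sqrtd_neg_one_sq] <;> norm_num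
    rw [hsq, neg_one_mul, Zsqrtd.re_neg, hJ]
    norm_num
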